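/- arXiv:2110.05693 — 3 statements merged into one kernel-verified Lean document; each statement's English description precedes it below -/
import Mathlib

section
/- Let F be a field, T_0 = diag(t₁,t₂) with t₁,t₂ ∈ F^×, and T = J_2 T_0. The map α_T : N_{2,8}(F) → H_9(F) defined by α_T(v(x,y,z)) = (x, y, tr(Tz)) is a surjective group homomorphism, and its kernel is { v(0,0,z) : z ∈ Mat_2^0(F), tr(Tz) = 0 }. -/
open Matrix

namespace GS

noncomputable section

/-- `Jmat F n` : the `n × n` matrix over `F` with ones on the antidiagonal, zeros elsewhere. -/
def Jmat (F : Type*) [Field F] (n : ℕ) : Matrix (Fin n) (Fin n) F :=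
  Matrix.of fun i j => if (i : ℕ) + (j : ℕ) = n - 1 then (1 : F) else 0

/-- The symplectic form matrix `((0, J_n), (-J_n, 0))` in `n × n` block form. -/
def OmegaMat (F : Type*) [Field F] (n : ℕ) : Matrix (Fin (n + n)) (Fin (n + n)) F :=
  Matrix.reindex finSumFinEquiv finSumFinEquiv
    (Matrix.fromBlocks 0 (Jmat F n) (-(Jmat F n)) 0)

/-- `Sp_{2n}(F) = { g : ᵗg Ω g = Ω }`. -/
def SpSet (F : Type*) [Field F] (n : ℕ) : Set (Matrix (Fin (n + n)) (Fin (n + n)) F) :=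
  {g | gᵀ * OmegaMat F n * g = OmegaMat F n}

/-- `Sp_4(F)`. -/
def Sp4 (F : Type*) [Field F] : Set (Matrix (Fin 4) (Fin 4) F) := SpSet F 2

/-- `Sp_8(F)`. -/
def Sp8 (F : Type*) [Field F] : Set (Matrix (Fin 8) (Fin 8) F) := SpSet F 4

/-- `Sp_16(F)`. -/
def Sp16 (F : Type*) [Field F] : Set (Matrix (Fin 16) (Fin 16) F) := SpSet F 8

/-- `Mat_2^0(F) = { A : ᵗA J₂ = J₂ A }`. -/
def Mat20 (F : Type*) [Field F] : Set (Matrix (Fin 2) (Fin 2) F) :=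
  {A | Aᵀ * Jmat F 2 = Jmat F 2 * A}

/-- `y* = J₂ ᵗy J₂`. -/
def starJ (F : Type*) [Field F] (y : Matrix (Fin 2) (Fin 2) F) : Matrix (Fin 2) (Fin 2) F :=
  Jmat F 2 * yᵀ * Jmat F 2

/-- Assemble an `8 × 8` matrix from sixteen `2 × 2` blocks. -/
def blk8 (F : Type*) [Field F] (B : Fin 4 → Fin 4 → Matrix (Fin 2) (Fin 2) F) :
    Matrix (Fin 8) (Fin 8) F :=
  Matrix.of fun i j =>
    B ⟨(i : ℕ) / 2, by have := i.isLt; omega⟩ ⟨(j : ℕ) / 2, by have := j.isLt; omega⟩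
      ⟨(i : ℕ) % 2, by omega⟩ ⟨(j : ℕ) % 2, by omega⟩

/-- The matrix `v(x, y, z)`: identity except block `(1,2) = x`, `(1,3) = y`,
`(1,4) = z`, `(2,4) = y* = J₂ ᵗy J₂`, `(3,4) = x* = -J₂ ᵗx J₂`. -/
def vMat (F : Type*) [Field F] (x y z : Matrix (Fin 2) (Fin 2) F) :
    Matrix (Fin 8) (Fin 8) F :=
  blk8 F fun bi bj =>
    if bi = bj then (1 : Matrix (Fin 2) (Fin 2) F)
    else if bi = 0 ∧ bj = 1 then x
    else if bi = 0 ∧ bj = 2 then y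
    else if bi = 0 ∧ bj = 3 then z
    else if bi = 1 ∧ bj = 3 then starJ F y
    else if bi = 2 ∧ bj = 3 then -(starJ F x)
    else 0

/-- `N_{2,8}(F)`. -/
def N28 (F : Type*) [Field F] : Set (Matrix (Fin 8) (Fin 8) F) :=
  {M | ∃ x y z : Matrix (Fin 2) (Fin 2) F,
    z - x * starJ F y ∈ Mat20 F ∧ M = vMat F x y z}

/-- The center subgroup `N_{2,8}^c(F) = { v(0,0,z) : z ∈ Mat_2^0(F) }`. -/
def N28c (F : Type*) [Field F] : Set (Matrix (Fin 8) (Fin 8) F) :=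
  {M | ∃ z ∈ Mat20 F, M = vMat F 0 0 z}

/-- The underlying set of the Heisenberg group `H_9(F)`. -/
abbrev H9 (F : Type*) [Field F] :=
  Matrix (Fin 2) (Fin 2) F × Matrix (Fin 2) (Fin 2) F × F

/-- The Heisenberg multiplication on `H_9(F)` attached to `T`. -/
def H9mul (F : Type*) [Field F] (T : Matrix (Fin 2) (Fin 2) F) (a b : H9 F) : H9 F :=
  (a.1 + b.1, a.2.1 + b.2.1,
    a.2.2 + b.2.2 +
      (T * (a.1 * (Jmat F 2 * b.2.1ᵀ * Jmat F 2) -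
            a.2.1 * (Jmat F 2 * b.1ᵀ * Jmat F 2))).trace)

/-- The `8 × 8` block diagonal matrix `diag(m, h, m')` with blocks of sizes `2, 4, 2`. -/
def diag242 (F : Type*) [Field F] (m : Matrix (Fin 2) (Fin 2) F)
    (h : Matrix (Fin 4) (Fin 4) F) (m' : Matrix (Fin 2) (Fin 2) F) :
    Matrix (Fin 8) (Fin 8) F :=
  Matrix.of fun i j =>
    if hi : (i : ℕ) < 2 then
      if hj : (j : ℕ) < 2 then m ⟨(i : ℕ), hi⟩ ⟨(j : ℕ), hj⟩ else 0
    else if hi2 : (i : ℕ) < 6 then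
      if hj2 : 2 ≤ (j : ℕ) ∧ (j : ℕ) < 6 then
        h ⟨(i : ℕ) - 2, by omega⟩ ⟨(j : ℕ) - 2, by omega⟩
      else 0
    else
      if hj3 : 6 ≤ (j : ℕ) then
        m' ⟨(i : ℕ) - 6, by have := i.isLt; omega⟩ ⟨(j : ℕ) - 6, by have := j.isLt; omega⟩
      else 0

/-- The segment (`{1,2}`, `{3,4,5,6}` or `{7,8}`) of an index in `Fin 8`. -/
def seg8 (i : Fin 8) : ℕ := if (i : ℕ) < 2 then 0 else if (i : ℕ) < 6 then 1 else 2

/-- `w = ((0, I₂), (I₂, 0))`. -/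
def wMat (F : Type*) [Field F] : Matrix (Fin 4) (Fin 4) F :=
  Matrix.reindex finSumFinEquiv finSumFinEquiv
    (Matrix.fromBlocks (0 : Matrix (Fin 2) (Fin 2) F) (1 : Matrix (Fin 2) (Fin 2) F)
      (1 : Matrix (Fin 2) (Fin 2) F) (0 : Matrix (Fin 2) (Fin 2) F))

/-- The embedding `t : Sp₄ × Sp₄ → Mat₁₆`, with respect to the partition of `{1,…,16}`
into `I₁ = {1,…,4}`, `I₂ = {5,6}`, `I₃ = {7,…,10}`, `I₄ = {11,12}`, `I₅ = {13,…,16}`: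
block `(I₁,I₁) = g₁`, `(I₃,I₃) = g₂`, `(I₅,I₅) = J₄ ᵗg₁⁻¹ J₄`, `(I₂,I₂) = g_{1,1}`,
`(I₂,I₄) = g_{1,2}`, `(I₄,I₂) = g_{1,3}`, `(I₄,I₄) = g_{1,4}`, all other blocks zero. -/
def tEmb (F : Type*) [Field F] (g₁ g₂ : Matrix (Fin 4) (Fin 4) F) :
    Matrix (Fin 16) (Fin 16) F :=
  Matrix.of fun i j =>
    if hi1 : (i : ℕ) < 4 then
      if hj1 : (j : ℕ) < 4 then g₁ ⟨(i : ℕ), hi1⟩ ⟨(j : ℕ), hj1⟩ else 0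
    else if hi2 : (i : ℕ) < 6 then
      if hj2 : 4 ≤ (j : ℕ) ∧ (j : ℕ) < 6 then
        g₁ ⟨(i : ℕ) - 4, by omega⟩ ⟨(j : ℕ) - 4, by omega⟩
      else if hj4 : 10 ≤ (j : ℕ) ∧ (j : ℕ) < 12 then
        g₁ ⟨(i : ℕ) - 4, by omega⟩ ⟨(j : ℕ) - 10 + 2, by omega⟩
      else 0
    else if hi3 : (i : ℕ) < 10 then
      if hj3 : 6 ≤ (j : ℕ) ∧ (j : ℕ) < 10 then
        g₂ ⟨(i : ℕ) - 6, by omega⟩ ⟨(j : ℕ) - 6, by omega⟩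
      else 0
    else if hi4 : (i : ℕ) < 12 then
      if hj2 : 4 ≤ (j : ℕ) ∧ (j : ℕ) < 6 then
        g₁ ⟨(i : ℕ) - 10 + 2, by omega⟩ ⟨(j : ℕ) - 4, by omega⟩
      else if hj4 : 10 ≤ (j : ℕ) ∧ (j : ℕ) < 12 then
        g₁ ⟨(i : ℕ) - 10 + 2, by omega⟩ ⟨(j : ℕ) - 10 + 2, by omega⟩
      else 0
    else
      if hj5 : 12 ≤ (j : ℕ) then
        (Jmat F 4 * (g₁⁻¹)ᵀ * Jmat F 4) ⟨(i : ℕ) - 12, by have := i.isLt; omega⟩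
          ⟨(j : ℕ) - 12, by have := j.isLt; omega⟩
      else 0

/-- `γ₁`: entry `(1,8) = -1`, entries `(k,k) = 1` for `2 ≤ k ≤ 7`, entry `(8,1) = 1`
(1-indexed), all other entries `0`. -/
def gamma1 (F : Type*) [Field F] : Matrix (Fin 8) (Fin 8) F :=
  Matrix.of fun i j =>
    if (i : ℕ) = 0 ∧ (j : ℕ) = 7 then -1
    else if (i : ℕ) = 7 ∧ (j : ℕ) = 0 then 1
    else if i = j ∧ 1 ≤ (i : ℕ) ∧ (i : ℕ) ≤ 6 then 1
    else 0

/-- `γ₂`: block (rows 1–2, columns 7–8) `= -I₂`, block (rows 3–6, columns 3–6) `= I₄`,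
block (rows 7–8, columns 1–2) `= I₂` (1-indexed), all other entries `0`. -/
def gamma2 (F : Type*) [Field F] : Matrix (Fin 8) (Fin 8) F :=
  Matrix.of fun i j =>
    if (i : ℕ) < 2 ∧ (j : ℕ) = (i : ℕ) + 6 then -1
    else if 2 ≤ (i : ℕ) ∧ (i : ℕ) < 6 ∧ i = j then 1
    else if 6 ≤ (i : ℕ) ∧ (j : ℕ) + 6 = (i : ℕ) then 1
    else 0

/-- The Siegel parabolic `P_8(F)` of `Sp_8(F)`: lower-left `4 × 4` block zero. -/
def P8 (F : Type*) [Field F] : Set (Matrix (Fin 8) (Fin 8) F) :=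
  {g | g ∈ Sp8 F ∧ ∀ i j : Fin 8, 4 ≤ (i : ℕ) → (j : ℕ) < 4 → g i j = 0}

/-- The Siegel parabolic `P_4(F)` of `Sp_4(F)`: lower-left `2 × 2` block zero. -/
def P4 (F : Type*) [Field F] : Set (Matrix (Fin 4) (Fin 4) F) :=
  {h | h ∈ Sp4 F ∧ ∀ i j : Fin 4, 2 ≤ (i : ℕ) → (j : ℕ) < 2 → h i j = 0}

/-- The span of the first two standard basis vectors `e₁, e₂` of `F^8`. -/
def E2 (F : Type*) [Field F] : Submodule F (Fin 8 → F) :=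
  Submodule.span F {Pi.single (0 : Fin 8) (1 : F), Pi.single (1 : Fin 8) (1 : F)}

/-- `P_{2,8}(F)`: elements of `Sp_8(F)` mapping the span of `e₁, e₂` onto itself. -/
def P28 (F : Type*) [Field F] : Set (Matrix (Fin 8) (Fin 8) F) :=
  {g | g ∈ Sp8 F ∧ Submodule.map g.mulVecLin (E2 F) = E2 F}

/-- The double coset `P_8(F) · γ · P_{2,8}(F)`. -/
def dcoset (F : Type*) [Field F] (γ : Matrix (Fin 8) (Fin 8) F) :
    Set (Matrix (Fin 8) (Fin 8) F) :=
  {g | ∃ p ∈ P8 F, ∃ q ∈ P28 F, g = p * γ * q}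

/-- The orbit of `ξ` under the right multiplication action of `GL₂(F)` on `Mat₂(F)`. -/
def rOrbit (F : Type*) [Field F] (ξ : Matrix (Fin 2) (Fin 2) F) :
    Set (Matrix (Fin 2) (Fin 2) F) :=
  {A | ∃ g, IsUnit g ∧ A = ξ * g}


theorem blk8_mul (F : Type*) [Field F] (B C : Fin 4 → Fin 4 → Matrix (Fin 2) (Fin 2) F) :
    blk8 F B * blk8 F C = blk8 F fun i j => ∑ k, B i k * C k j := by
  ext i j
  simp [blk8, Matrix.mul_apply, Matrix.sum_apply, Fin.sum_univ_eight, Fin.sum_univ_four]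
  ring

theorem starJ_add (F : Type*) [Field F] (x y : Matrix (Fin 2) (Fin 2) F) :
    starJ F (x + y) = starJ F x + starJ F y := by
  simp [starJ, Matrix.mul_add, Matrix.add_mul]

theorem mem_Mat20_iff (F : Type*) [Field F] (A : Matrix (Fin 2) (Fin 2) F) :
    A ∈ Mat20 F ↔ A 0 0 = A 1 1 := by
  simp only [Mat20, Set.mem_ofPred_eq, ← Matrix.ext_iff, Fin.forall_fin_two]
  simp [Matrix.mul_apply, Jmat, eq_comm]

theorem vMat_mul (F : Type*) [Field F] (x₁ y₁ z₁ x₂ y₂ z₂ : Matrix (Fin 2) (Fin 2) F) :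
    vMat F x₁ y₁ z₁ * vMat F x₂ y₂ z₂ =
      vMat F (x₁ + x₂) (y₁ + y₂) (z₁ + z₂ + (x₁ * starJ F y₂ - y₁ * starJ F x₂)) := by
  unfold vMat
  rw [blk8_mul]
  congr 1
  funext i j
  fin_cases i <;> fin_cases j <;> simp [Fin.sum_univ_four, starJ_add] <;> abel

theorem mul_cocycle_mem_Mat20 (F : Type*) [Field F]
    {x₁ y₁ z₁ x₂ y₂ z₂ : Matrix (Fin 2) (Fin 2) F}
    (h₁ : z₁ - x₁ * starJ F y₁ ∈ Mat20 F) (h₂ : z₂ - x₂ * starJ F y₂ ∈ Mat20 F) :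
    z₁ + z₂ + (x₁ * starJ F y₂ - y₁ * starJ F x₂) - (x₁ + x₂) * starJ F (y₁ + y₂) ∈
      Mat20 F := by
  rw [mem_Mat20_iff] at *
  simp [starJ, Matrix.mul_apply, Jmat] at *
  linear_combination h₁ + h₂

theorem trace_Jmat_diagonal_mul (F : Type*) [Field F] (t₁ t₂ : F)
    (A : Matrix (Fin 2) (Fin 2) F) :
    (Jmat F 2 * Matrix.diagonal ![t₁, t₂] * A).trace = t₁ * A 0 1 + t₂ * A 1 0 := by
  simp [Matrix.trace, Matrix.mul_apply, Jmat, Matrix.diagonal_apply, add_comm]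

/-- `α_T : N_{2,8}(F) → H_9(F)`, `v(x,y,z) ↦ (x, y, tr(Tz))`, is a
surjective group homomorphism with kernel `{ v(0,0,z) : z ∈ Mat_2^0(F), tr(Tz) = 0 }`. -/
theorem statement3 (F : Type*) [Field F] (t₁ t₂ : F) (ht₁ : t₁ ≠ 0) (ht₂ : t₂ ≠ 0)
    (T : Matrix (Fin 2) (Fin 2) F)
    (hT : T = Jmat F 2 * Matrix.diagonal ![t₁, t₂])
    (αT : Matrix (Fin 8) (Fin 8) F → H9 F)
    (hα : ∀ x y z : Matrix (Fin 2) (Fin 2) F, z - x * starJ F y ∈ Mat20 F →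
      αT (vMat F x y z) = (x, y, (T * z).trace)) :
    (∀ M₁ ∈ N28 F, ∀ M₂ ∈ N28 F, αT (M₁ * M₂) = H9mul F T (αT M₁) (αT M₂)) ∧
    (∀ a : H9 F, ∃ M ∈ N28 F, αT M = a) ∧
    ({M | M ∈ N28 F ∧ αT M = ((0, 0, 0) : H9 F)} =
      {M | ∃ z ∈ Mat20 F, (T * z).trace = 0 ∧ M = vMat F 0 0 z}) := by
  refine ⟨?_, ?_, ?_⟩
  · rintro _ ⟨x₁, y₁, z₁, h₁, rfl⟩ _ ⟨x₂, y₂, z₂, h₂, rfl⟩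
    rw [vMat_mul, hα _ _ _ (mul_cocycle_mem_Mat20 F h₁ h₂), hα _ _ _ h₁, hα _ _ _ h₂]
    simp only [H9mul, starJ, Matrix.mul_add, Matrix.trace_add]
  · rintro ⟨x, y, c⟩
    let u : F := t₁⁻¹ * (c - (T * (x * starJ F y)).trace)
    have hmem : (!![0, u; 0, 0] + x * starJ F y) - x * starJ F y ∈ Mat20 F := by
      simp [mem_Mat20_iff]
    refine ⟨_, ⟨x, y, _, hmem, rfl⟩, ?_⟩
    have htr : (T * !![0, u; 0, 0]).trace = t₁ * u := by
      simp [hT, trace_Jmat_diagonal_mul]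
    rw [hα _ _ _ hmem, Matrix.mul_add, Matrix.trace_add, htr]
    simp [u, ht₁]
  · have hcenter (z : Matrix (Fin 2) (Fin 2) F) : z - 0 * starJ F 0 = z := by simp
    ext M
    constructor
    · rintro ⟨⟨x, y, z, h, rfl⟩, hM⟩
      rw [hα _ _ _ h] at hM
      simp only [Prod.mk.injEq] at hM
      obtain ⟨rfl, rfl, htr⟩ := hM
      exact ⟨z, hcenter z ▸ h, htr, rfl⟩
    · rintro ⟨z, hz, htr, rfl⟩
      have h : z - 0 * starJ F 0 ∈ Mat20 F := (hcenter z).symm ▸ hz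
      exact ⟨⟨0, 0, z, h, rfl⟩, by rw [hα _ _ _ h, htr]⟩

end

end GS
end

section
/- Let F be a field. For all g₁, g₂ ∈ Sp_4(F) one has the identity t(I_4, g₁g₂) · t(g₁^ι, I_4) = t(g₁^ι, g₁) · t(I_4, g₂) in Sp_16(F), where g^ι = w·g·w with w = ((0, I_2),(I_2, 0)). -/
open Matrix

namespace GS

noncomputable section

/-- The index set of `tEmb` as four copies of `Fin 4`: `I₁`, `I₂ ∪ I₄`, `I₃` and `I₅`. -/
def tIndex : Fin 16 ≃ Fin 4 × Fin 4 where
  toFun := ![(0, 0), (1, 0), (2, 0), (3, 0), (0, 1), (1, 1), (0, 2), (1, 2), (2, 2), (3, 2),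
    (2, 1), (3, 1), (0, 3), (1, 3), (2, 3), (3, 3)]
  invFun p := ![![0, 1, 2, 3], ![4, 5, 10, 11], ![6, 7, 8, 9], ![12, 13, 14, 15]] p.2 p.1
  left_inv := by decide
  right_inv := by decide

theorem tEmb_eq_blockDiagonal (F : Type*) [Field F] (a b : Matrix (Fin 4) (Fin 4) F) :
    tEmb F a b =
      (blockDiagonal ![a, a, b, Jmat F 4 * (a⁻¹)ᵀ * Jmat F 4]).submatrix tIndex tIndex := by
  ext i j
  generalize hc : Jmat F 4 * (a⁻¹)ᵀ * Jmat F 4 = c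
  simp only [tEmb, hc]
  fin_cases i <;> fin_cases j <;> rfl

theorem Jmat_four_mul_self (F : Type*) [Field F] : Jmat F 4 * Jmat F 4 = 1 := by
  ext i j
  fin_cases i <;> fin_cases j <;> simp [Jmat, Matrix.mul_apply, Fin.sum_univ_four]

theorem tEmb_mul_tEmb (F : Type*) [Field F] (a b c d : Matrix (Fin 4) (Fin 4) F) :
    tEmb F a b * tEmb F c d = tEmb F (a * c) (b * d) := by
  have h : Jmat F 4 * (a⁻¹)ᵀ * Jmat F 4 * (Jmat F 4 * (c⁻¹)ᵀ * Jmat F 4) =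
      Jmat F 4 * ((a * c)⁻¹)ᵀ * Jmat F 4 := by
    rw [Matrix.mul_inv_rev, Matrix.transpose_mul]
    calc _ = Jmat F 4 * (a⁻¹)ᵀ * (Jmat F 4 * Jmat F 4) * (c⁻¹)ᵀ * Jmat F 4 := by
          simp only [Matrix.mul_assoc]
      _ = _ := by rw [Jmat_four_mul_self, Matrix.mul_one]; simp only [Matrix.mul_assoc]
  simp only [tEmb_eq_blockDiagonal]
  rw [Matrix.submatrix_mul_equiv, ← Matrix.blockDiagonal_mul, ← h]
  congr 2
  ext k : 1
  fin_cases k <;> rfl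

/-- `t(I₄, g₁g₂) · t(g₁^ι, I₄) = t(g₁^ι, g₁) · t(I₄, g₂)` in `Sp_16(F)`. -/
theorem statement9 (F : Type*) [Field F] (g₁ g₂ : Matrix (Fin 4) (Fin 4) F)
    (h₁ : g₁ ∈ Sp4 F) (h₂ : g₂ ∈ Sp4 F) :
    tEmb F 1 (g₁ * g₂) * tEmb F (wMat F * g₁ * wMat F) 1 =
      tEmb F (wMat F * g₁ * wMat F) g₁ * tEmb F 1 g₂ := by
  simp only [tEmb_mul_tEmb, Matrix.one_mul, Matrix.mul_one]

end

end GS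
end

section
/- Let F be a field. Define γ₁ ∈ Mat_8(F) as the matrix with entry (1,8) equal to −1, entries (k,k) equal to 1 for 2 ≤ k ≤ 7, entry (8,1) equal to 1, and all other entries 0; and define γ₂ ∈ Mat_8(F) in 2×2 block form as the matrix with block (rows 1–2, columns 7–8) equal to −I_2, block (rows 3–6, columns 3–6) equal to I_4, block (rows 7–8, columns 1–2) equal to I_2, and all other entries 0. Then γ₁, γ₂ ∈ Sp_8(F), and Sp_8(F) is the union of the three double cosets P_8(F)·P_{2,8}(F), P_8(F)·γ₁·P_{2,8}(F), and P_8(F)·γ₂·P_{2,8}(F), which are pairwise disjoint. -/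
open Matrix

namespace GS

noncomputable section

/-- The splitting of the indices of `F^8` into an upper and a lower half. -/
def halves : Fin 4 ⊕ Fin 4 ≃ Fin 8 := finSumFinEquiv

@[simp] lemma halves_inl_val (i : Fin 4) : (halves (Sum.inl i) : ℕ) = i := rfl

@[simp] lemma halves_inr_val (i : Fin 4) : (halves (Sum.inr i) : ℕ) = 4 + i := rfl

/-- The vector of `F^8` with upper half `x` and lower half `y`. -/
def vec8 {F : Type*} (x y : Fin 4 → F) : Fin 8 → F :=
  Sum.elim x y ∘ halves.symm

/-- The standard Lagrangian subspace spanned by `e₁, …, e₄`. -/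
def lagrangian (F : Type*) [Field F] : Submodule F (Fin 8 → F) where
  carrier := {v | ∀ i : Fin 8, 4 ≤ (i : ℕ) → v i = 0}
  add_mem' {a b} ha hb i hi := by simp [ha i hi, hb i hi]
  zero_mem' i _ := rfl
  smul_mem' c a ha i hi := by simp [ha i hi]

section
variable {F : Type*} [Field F]

lemma Jmat_mul_self : Jmat F 4 * Jmat F 4 = 1 := by
  ext i j
  fin_cases i <;> fin_cases j <;> simp [Jmat, Matrix.mul_apply, Fin.sum_univ_four]

lemma Jmat_transpose : (Jmat F 4)ᵀ = Jmat F 4 := by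
  ext i j
  simp [Jmat, add_comm]

lemma Jmat_mulVec_apply (v : Fin 4 → F) (i : Fin 4) : (Jmat F 4 *ᵥ v) i = v i.rev := by
  fin_cases i <;> simp [Jmat, Matrix.mulVec, dotProduct, Fin.sum_univ_four]

lemma Jmat_mulVec_Jmat_mulVec (v : Fin 4 → F) : Jmat F 4 *ᵥ (Jmat F 4 *ᵥ v) = v := by
  rw [mulVec_mulVec, Jmat_mul_self, one_mulVec]

lemma Omega_eq : OmegaMat F 4 =
    reindex halves halves (fromBlocks 0 (Jmat F 4) (-(Jmat F 4)) 0) := rfl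

lemma Omega_mul_self : OmegaMat F 4 * OmegaMat F 4 = -1 := by
  rw [Omega_eq, reindex_apply, submatrix_mul_equiv, fromBlocks_multiply]
  simp only [mul_zero, zero_mul, zero_add, add_zero, mul_neg, neg_mul, Jmat_mul_self, neg_zero]
  rw [show fromBlocks (-1) 0 0 (-1) = -(1 : Matrix (Fin 4 ⊕ Fin 4) (Fin 4 ⊕ Fin 4) F) by
    rw [← fromBlocks_one, fromBlocks_neg, neg_zero]]
  change -(submatrix (1 : Matrix _ _ F) halves.symm halves.symm) = _
  rw [submatrix_one_equiv]

lemma reindex_mem_Sp8 (a b c d : Matrix (Fin 4) (Fin 4) F) :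
    (reindex halves halves (fromBlocks a b c d) : Matrix (Fin 8) (Fin 8) F) ∈ Sp8 F ↔
      aᵀ * Jmat F 4 * c = cᵀ * Jmat F 4 * a ∧ aᵀ * Jmat F 4 * d - cᵀ * Jmat F 4 * b = Jmat F 4 ∧
      bᵀ * Jmat F 4 * c - dᵀ * Jmat F 4 * a = - Jmat F 4 ∧
      bᵀ * Jmat F 4 * d = dᵀ * Jmat F 4 * b := by
  change _ * _ * _ = _ ↔ _
  rw [Omega_eq, reindex_apply, reindex_apply, transpose_submatrix, submatrix_mul_equiv,
    submatrix_mul_equiv, ← reindex_apply, ← reindex_apply, (reindex halves halves).injective.eq_iff,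
    fromBlocks_transpose, fromBlocks_multiply, fromBlocks_multiply, fromBlocks_inj]
  simp only [mul_zero, zero_add, add_zero, mul_neg, neg_mul, neg_add_eq_sub, sub_eq_zero]

lemma reindex_mulVec_vec8 (a b c d : Matrix (Fin 4) (Fin 4) F) (x y : Fin 4 → F) :
    (reindex halves halves (fromBlocks a b c d) : Matrix (Fin 8) (Fin 8) F) *ᵥ
      vec8 x y = vec8 (a *ᵥ x + b *ᵥ y) (c *ᵥ x + d *ᵥ y) := by
  simp only [reindex_apply, vec8]
  rw [submatrix_mulVec_equiv]
  congr 1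
  ext i
  simp [Function.comp_assoc, fromBlocks_mulVec]

lemma exists_eq_vec8 {R : Type*} (v : Fin 8 → R) : ∃ x y, v = vec8 x y :=
  ⟨_, _, (halves.comp_symm_eq _ _).2
    (Sum.elim_comp_inl_inr (v ∘ halves)) |>.symm⟩

lemma vec8_mem_lagrangian {x y : Fin 4 → F} : vec8 x y ∈ lagrangian F ↔ y = 0 := by
  refine ⟨fun h => ?_, ?_⟩
  · ext i
    simpa [vec8] using h (halves (Sum.inr i)) (by simp)
  · rintro rfl i hi
    obtain ⟨j, rfl⟩ := halves.surjective i
    rcases j with j | j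
    · exact absurd hi (by simp)
    · simp [vec8]

lemma vec8_dot_Omega (x y x' y' : Fin 4 → F) :
    vec8 x y ⬝ᵥ (OmegaMat F 4 *ᵥ vec8 x' y') =
      x ⬝ᵥ (Jmat F 4 *ᵥ y') - y ⬝ᵥ (Jmat F 4 *ᵥ x') := by
  have := reindex_mulVec_vec8 0 (Jmat F 4) (-(Jmat F 4)) 0 x' y'
  rw [Omega_eq, this]
  simp only [vec8]
  rw [comp_equiv_dotProduct_comp_equiv]
  simp [sub_eq_add_neg, neg_mulVec]

lemma vec8_smul_add (s t : F) (x y x' y' : Fin 4 → F) :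
    s • vec8 x y + t • vec8 x' y' = vec8 (s • x + t • x') (s • y + t • y') := by
  ext i
  obtain ⟨j, rfl⟩ := halves.surjective i
  rcases j with j | j <;> simp [vec8]

lemma vec8_zero : vec8 (0 : Fin 4 → F) 0 = 0 := by
  ext i
  obtain ⟨j, rfl⟩ := halves.surjective i
  rcases j with j | j <;> simp [vec8]

lemma Sp8.left_inv {g : Matrix (Fin 8) (Fin 8) F} (hg : g ∈ Sp8 F) :
    (-(OmegaMat F 4 * gᵀ * OmegaMat F 4) : Matrix (Fin 8) (Fin 8) F) * g = 1 := by
  have h : gᵀ * OmegaMat F 4 * g = OmegaMat F 4 := hg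
  calc _ = -(OmegaMat F 4 * (gᵀ * OmegaMat F 4 * g)) := by simp only [neg_mul, mul_assoc]
    _ = 1 := by rw [h, Omega_mul_self, neg_neg]

lemma Sp8.isUnit {g : Matrix (Fin 8) (Fin 8) F} (hg : g ∈ Sp8 F) : IsUnit g :=
  IsUnit.of_mul_eq_one_right _ (Sp8.left_inv hg)

lemma Sp8.mul {g h : Matrix (Fin 8) (Fin 8) F} (hg : g ∈ Sp8 F) (hh : h ∈ Sp8 F) :
    g * h ∈ Sp8 F := by
  have hg' : gᵀ * OmegaMat F 4 * g = OmegaMat F 4 := hg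
  have hh' : hᵀ * OmegaMat F 4 * h = OmegaMat F 4 := hh
  change (g * h)ᵀ * OmegaMat F 4 * (g * h) = OmegaMat F 4
  calc _ = hᵀ * (gᵀ * OmegaMat F 4 * g) * h := by simp only [transpose_mul, mul_assoc]
    _ = _ := by rw [hg', hh']

lemma Sp8.of_mul {g h : Matrix (Fin 8) (Fin 8) F} (hg : g ∈ Sp8 F) (hgh : g * h ∈ Sp8 F) :
    h ∈ Sp8 F := by
  have hg' : gᵀ * OmegaMat F 4 * g = OmegaMat F 4 := hg
  have hh' : (g * h)ᵀ * OmegaMat F 4 * (g * h) = OmegaMat F 4 := hgh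
  change hᵀ * OmegaMat F 4 * h = OmegaMat F 4
  calc _ = hᵀ * (gᵀ * OmegaMat F 4 * g) * h := by rw [hg']
    _ = (g * h)ᵀ * OmegaMat F 4 * (g * h) := by simp only [transpose_mul, mul_assoc]
    _ = _ := hh'

lemma Sp8.one : (1 : Matrix (Fin 8) (Fin 8) F) ∈ Sp8 F := by
  change (1 : Matrix (Fin 8) (Fin 8) F)ᵀ * OmegaMat F 4 * 1 = OmegaMat F 4
  simp

lemma Sp8.injective {g : Matrix (Fin 8) (Fin 8) F} (hg : g ∈ Sp8 F) :
    Function.Injective g.mulVecLin :=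
  mulVec_injective_iff_isUnit.2 (Sp8.isUnit hg)

lemma Sp8.dot_Omega {g : Matrix (Fin 8) (Fin 8) F} (hg : g ∈ Sp8 F) (x y : Fin 8 → F) :
    (g *ᵥ x) ⬝ᵥ (OmegaMat F 4 *ᵥ (g *ᵥ y)) = x ⬝ᵥ (OmegaMat F 4 *ᵥ y) := by
  have h : gᵀ * OmegaMat F 4 * g = OmegaMat F 4 := hg
  conv_rhs => rw [← h]
  rw [← vecMul_transpose, ← dotProduct_mulVec, mulVec_mulVec, mulVec_mulVec, mul_assoc]

lemma single_eq_vec8_left (i : Fin 4) :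
    (Pi.single (halves (Sum.inl i)) 1 : Fin 8 → F) =
      vec8 (Pi.single i 1) 0 := by
  fin_cases i <;> ext j <;> fin_cases j <;> rfl

lemma single_eq_vec8_right (i : Fin 4) :
    (Pi.single (halves (Sum.inr i)) 1 : Fin 8 → F) =
      vec8 0 (Pi.single i 1) := by
  fin_cases i <;> ext j <;> fin_cases j <;> rfl

lemma map_E2 (g : Matrix (Fin 8) (Fin 8) F) :
    (E2 F).map g.mulVecLin =
      Submodule.span F {g *ᵥ Pi.single 0 1, g *ᵥ Pi.single 1 1} := by
  rw [E2, Submodule.map_span, Set.image_pair]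
  rfl

lemma map_one_E2 : (E2 F).map (1 : Matrix (Fin 8) (Fin 8) F).mulVecLin =
    Submodule.span F {vec8 (Pi.single 0 1) 0, vec8 (Pi.single 1 1) 0} := by
  rw [map_E2, one_mulVec, one_mulVec, ← single_eq_vec8_left, ← single_eq_vec8_left]
  rfl

lemma map_gamma1_E2 : (E2 F).map (gamma1 F).mulVecLin =
    Submodule.span F {vec8 (Pi.single 1 1) 0, vec8 0 (Pi.single 3 1)} := by
  rw [map_E2, Set.pair_comm, ← single_eq_vec8_left, ← single_eq_vec8_right]
  change _ = Submodule.span F {Pi.single 1 1, Pi.single 7 1}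
  congr 2
  · ext j; fin_cases j <;> simp [gamma1]
  · congr 1; ext j; fin_cases j <;> simp [gamma1]

lemma map_gamma2_E2 : (E2 F).map (gamma2 F).mulVecLin =
    Submodule.span F {vec8 0 (Pi.single 2 1), vec8 0 (Pi.single 3 1)} := by
  rw [map_E2, ← single_eq_vec8_right, ← single_eq_vec8_right]
  change _ = Submodule.span F {Pi.single 6 1, Pi.single 7 1}
  congr 2
  · ext j; fin_cases j <;> simp [gamma2]
  · congr 1; ext j; fin_cases j <;> simp [gamma2]

lemma gamma1_mem_Sp8 : gamma1 F ∈ Sp8 F := by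
  have : gamma1 F = reindex halves halves (fromBlocks
      !![0, 0, 0, 0; 0, 1, 0, 0; 0, 0, 1, 0; 0, 0, 0, 1]
      !![0, 0, 0, -1; 0, 0, 0, 0; 0, 0, 0, 0; 0, 0, 0, 0]
      !![0, 0, 0, 0; 0, 0, 0, 0; 0, 0, 0, 0; 1, 0, 0, 0]
      !![1, 0, 0, 0; 0, 1, 0, 0; 0, 0, 1, 0; 0, 0, 0, 0]) := by
    ext i j
    fin_cases i <;> fin_cases j <;> rfl
  rw [this, reindex_mem_Sp8]
  refine ⟨?_, ?_, ?_, ?_⟩ <;> ext i j <;> fin_cases i <;> fin_cases j <;>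
    simp [Matrix.mul_apply, Fin.sum_univ_four, Jmat]

lemma gamma2_mem_Sp8 : gamma2 F ∈ Sp8 F := by
  have : gamma2 F = reindex halves halves (fromBlocks
      !![0, 0, 0, 0; 0, 0, 0, 0; 0, 0, 1, 0; 0, 0, 0, 1]
      !![0, 0, -1, 0; 0, 0, 0, -1; 0, 0, 0, 0; 0, 0, 0, 0]
      !![0, 0, 0, 0; 0, 0, 0, 0; 1, 0, 0, 0; 0, 1, 0, 0]
      !![1, 0, 0, 0; 0, 1, 0, 0; 0, 0, 0, 0; 0, 0, 0, 0]) := by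
    ext i j
    fin_cases i <;> fin_cases j <;> rfl
  rw [this, reindex_mem_Sp8]
  refine ⟨?_, ?_, ?_, ?_⟩ <;> ext i j <;> fin_cases i <;> fin_cases j <;>
    simp [Matrix.mul_apply, Fin.sum_univ_four, Jmat]

lemma comap_lagrangian {p : Matrix (Fin 8) (Fin 8) F} (hp : p ∈ P8 F) :
    (lagrangian F).comap p.mulVecLin = lagrangian F := by
  have hinj := Sp8.injective hp.1
  have hle : (lagrangian F).map p.mulVecLin ≤ lagrangian F := by
    rintro _ ⟨v, hv, rfl⟩ i hi
    change ∑ j, p i j * v j = 0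
    refine Finset.sum_eq_zero fun j _ => ?_
    by_cases hj : (j : ℕ) < 4
    · simp [hp.2 i j hi hj]
    · simp [hv j (not_lt.1 hj)]
  have heq : (lagrangian F).map p.mulVecLin = lagrangian F :=
    Submodule.eq_of_le_of_finrank_eq hle
      (Submodule.equivMapOfInjective _ hinj (lagrangian F)).finrank_eq.symm
  conv_lhs => rw [← heq]
  exact Submodule.comap_map_eq_of_injective hinj _

lemma map_E2_of_mem_dcoset {g γ : Matrix (Fin 8) (Fin 8) F} (hg : g ∈ dcoset F γ) :
    ∃ p ∈ P8 F, (E2 F).map g.mulVecLin = ((E2 F).map γ.mulVecLin).map p.mulVecLin := by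
  obtain ⟨p, hp, q, hq, rfl⟩ := hg
  refine ⟨p, hp, ?_⟩
  rw [mulVecLin_mul, mulVecLin_mul, Submodule.map_comp, hq.2, Submodule.map_comp]

lemma le_lagrangian_iff_of_mem_dcoset {g γ : Matrix (Fin 8) (Fin 8) F} (hg : g ∈ dcoset F γ) :
    (E2 F).map g.mulVecLin ≤ lagrangian F ↔ (E2 F).map γ.mulVecLin ≤ lagrangian F := by
  obtain ⟨p, hp, h⟩ := map_E2_of_mem_dcoset hg
  rw [h, Submodule.map_le_iff_le_comap, comap_lagrangian hp]

lemma disjoint_lagrangian_iff_of_mem_dcoset {g γ : Matrix (Fin 8) (Fin 8) F}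
    (hg : g ∈ dcoset F γ) :
    Disjoint ((E2 F).map g.mulVecLin) (lagrangian F) ↔
      Disjoint ((E2 F).map γ.mulVecLin) (lagrangian F) := by
  obtain ⟨p, hp, h⟩ := map_E2_of_mem_dcoset hg
  have hL : (lagrangian F).map p.mulVecLin ≤ lagrangian F := by
    rw [Submodule.map_le_iff_le_comap, comap_lagrangian hp]
  have hinj := Sp8.injective hp.1
  rw [h, Submodule.disjoint_def, Submodule.disjoint_def]
  refine ⟨fun H v hv hvL => ?_, ?_⟩
  · exact hinj ((H _ (Submodule.mem_map_of_mem hv) (hL (Submodule.mem_map_of_mem hvL))).trans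
      (map_zero _).symm)
  · rintro H _ ⟨v, hv, rfl⟩ hvL
    rw [H v hv (by rw [← comap_lagrangian hp]; exact hvL), map_zero]

lemma mem_dcoset {g γ p : Matrix (Fin 8) (Fin 8) F} (hg : g ∈ Sp8 F) (hγ : γ ∈ Sp8 F)
    (hp : p ∈ P8 F)
    (h : ((E2 F).map γ.mulVecLin).map p.mulVecLin = (E2 F).map g.mulVecLin) :
    g ∈ dcoset F γ := by
  have hpγ := Sp8.mul hp.1 hγ
  obtain ⟨u, hu⟩ := Sp8.isUnit hpγ
  have hmul : p * γ * (u⁻¹.val * g) = g := by rw [← mul_assoc, ← hu, Units.mul_inv, one_mul]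
  refine ⟨p, hp, u⁻¹.val * g, ⟨Sp8.of_mul hpγ (hmul.symm ▸ hg), ?_⟩, hmul.symm⟩
  apply Submodule.map_injective_of_injective (Sp8.injective hpγ)
  rw [← Submodule.map_comp, ← mulVecLin_mul, hmul, mulVecLin_mul, Submodule.map_comp, h]

/-- Elements of the Siegel parabolic in Levi decomposition. -/
lemma exists_mem_P8 {a d T : Matrix (Fin 4) (Fin 4) F} (h : aᵀ * Jmat F 4 * d = Jmat F 4)
    (hT : Tᵀ = T) : ∃ p ∈ P8 F, ∀ x y,
      p *ᵥ vec8 x y = vec8 (a *ᵥ (x + Jmat F 4 *ᵥ (T *ᵥ y))) (d *ᵥ y) := by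
  have h' : dᵀ * Jmat F 4 * a = Jmat F 4 := by
    simpa [Jmat_transpose, mul_assoc] using congrArg transpose h
  refine ⟨(reindex halves halves
    (fromBlocks a (a * Jmat F 4 * T) 0 d) : Matrix (Fin 8) (Fin 8) F),
    ⟨(reindex_mem_Sp8 _ _ _ _).2 ⟨by simp, by simpa using h, by simp [h'], ?_⟩, ?_⟩, ?_⟩
  · calc _ = T * (Jmat F 4 * (aᵀ * Jmat F 4 * d)) := by
          simp only [transpose_mul, hT, Jmat_transpose, mul_assoc]
      _ = (dᵀ * Jmat F 4 * a) * Jmat F 4 * T := by rw [h, h', Jmat_mul_self, mul_one, one_mul]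
      _ = _ := by simp only [mul_assoc]
  · intro i j hi hj
    obtain ⟨i, rfl⟩ := halves.surjective i
    obtain ⟨j, rfl⟩ := halves.surjective j
    rcases i with i | i
    · exact absurd hi (by simp)
    · rcases j with j | j
      · simp
      · exact absurd hj (by simp)
  · intro x y
    rw [reindex_mulVec_vec8]
    simp [mulVec_add, mulVec_mulVec, mul_assoc]

lemma dot_Jmat_of_dual {a d : Matrix (Fin 4) (Fin 4) F} (h : aᵀ * Jmat F 4 * d = Jmat F 4)
    (x y : Fin 4 → F) : (a *ᵥ x) ⬝ᵥ (Jmat F 4 *ᵥ (d *ᵥ y)) = x ⬝ᵥ (Jmat F 4 *ᵥ y) := by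
  conv_rhs => rw [← h]
  rw [← vecMul_transpose, ← dotProduct_mulVec, mulVec_mulVec, mulVec_mulVec, mul_assoc]

lemma exists_symm_of_columns (s t : Fin 4 → F) (h : s 3 = t 2) :
    ∃ T : Matrix (Fin 4) (Fin 4) F, Tᵀ = T ∧ T *ᵥ Pi.single 2 1 = s ∧ T *ᵥ Pi.single 3 1 = t := by
  refine ⟨!![0, 0, s 0, t 0; 0, 0, s 1, t 1; s 0, s 1, s 2, t 2; t 0, t 1, s 3, t 3], ?_, ?_, ?_⟩
  · ext i j; fin_cases i <;> fin_cases j <;> simp [h]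
  · ext i; fin_cases i <;> simp [h]
  · ext i; fin_cases i <;> simp

lemma exists_isUnit_mulVec_single {n : ℕ} {i j : Fin n} (hij : i ≠ j) {u v : Fin n → F}
    (h : LinearIndependent F ![u, v]) :
    ∃ a : Matrix (Fin n) (Fin n) F, IsUnit a ∧ a *ᵥ Pi.single i 1 = u ∧
      a *ᵥ Pi.single j 1 = v := by
  have h₀ : LinearIndependent F ![(Pi.single i 1 : Fin n → F), Pi.single j 1] := by
    rw [LinearIndependent.pair_iff]
    intro s t hst
    have hi := congrFun hst i
    have hj := congrFun hst j
    simp [hij, hij.symm] at hi hj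
    exact ⟨hi, hj⟩
  obtain ⟨f, hf⟩ := Submodule.exists_linearEquiv_restrict_eq
    (h₀.linearCombinationEquiv.symm ≪≫ₗ h.linearCombinationEquiv)
  have key (k : Fin 2) : f (![(Pi.single i 1 : Fin n → F), Pi.single j 1] k) = ![u, v] k := by
    rw [← hf ⟨_, Submodule.subset_span ⟨k, rfl⟩⟩, LinearEquiv.trans_apply]
    have := h₀.repr_eq_single k ⟨_, Submodule.subset_span ⟨k, rfl⟩⟩ rfl
    rw [LinearIndependent.repr] at this
    erw [this]
    simp
  refine ⟨LinearMap.toMatrix' f, ?_, ?_, ?_⟩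
  · exact mulVec_injective_iff_isUnit.1 fun x y hxy => f.injective (by simpa using hxy)
  · rw [LinearMap.toMatrix'_mulVec]; exact key 0
  · rw [LinearMap.toMatrix'_mulVec]; exact key 1

lemma exists_isUnit_mulVec_transpose_mulVec {x φ : Fin 4 → F} (hx : x ≠ 0) (hφ : φ ≠ 0)
    (h : φ ⬝ᵥ x = 0) : ∃ a : Matrix (Fin 4) (Fin 4) F, IsUnit a ∧ a *ᵥ Pi.single 1 1 = x ∧
      aᵀ *ᵥ φ = Pi.single 0 1 := by
  obtain ⟨i, hi⟩ := Function.ne_iff.1 hφ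
  have hu : φ ⬝ᵥ Pi.single i (φ i)⁻¹ = 1 := by simpa using mul_inv_cancel₀ hi
  have hli : LinearIndependent F ![Pi.single i (φ i)⁻¹, x] := by
    rw [LinearIndependent.pair_iff]
    intro s t hst
    have hs : s = 0 := by
      have := congrArg (φ ⬝ᵥ ·) hst
      simpa only [dotProduct_add, dotProduct_smul, hu, h, smul_eq_mul, mul_one, mul_zero,
        add_zero, dotProduct_zero] using this
    subst hs
    simpa [hx] using hst
  obtain ⟨b, hb, hb0, hb1⟩ := exists_isUnit_mulVec_single (i := (0 : Fin 4)) (j := 1)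
    (by decide) hli
  have h0 : (bᵀ *ᵥ φ) 0 = 1 := by
    rw [← hu, ← hb0, dotProduct_mulVec, ← mulVec_transpose, dotProduct_single_one]
  have h1 : (bᵀ *ᵥ φ) 1 = 0 := by
    rw [← h, ← hb1, dotProduct_mulVec, ← mulVec_transpose, dotProduct_single_one]
  generalize hψ : bᵀ *ᵥ φ = ψ at h0 h1
  let n : Matrix (Fin 4) (Fin 4) F :=
    !![1, 0, -ψ 2, -ψ 3; 0, 1, 0, 0; 0, 0, 1, 0; 0, 0, 0, 1]
  have hn : IsUnit n := by
    rw [isUnit_iff_isUnit_det, det_of_isUpperTriangular]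
    · simp [n, Fin.prod_univ_four]
    · intro i j hij
      fin_cases i <;> fin_cases j <;> first | rfl | exact absurd hij (by decide)
  refine ⟨b * n, hb.mul hn, ?_, ?_⟩
  · rw [← mulVec_mulVec, ← hb1]
    congr 1
    ext j; fin_cases j <;> simp [n]
  · rw [transpose_mul, ← mulVec_mulVec]
    rw [hψ]
    ext j
    fin_cases j <;> simp [n, mulVec, dotProduct, Fin.sum_univ_four, h0, h1]

lemma finrank_map_E2_le (g : Matrix (Fin 8) (Fin 8) F) :
    Module.finrank F ((E2 F).map g.mulVecLin) ≤ 2 := by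
  classical
  rw [map_E2]
  refine (finrank_span_le_card _).trans ?_
  rw [Set.toFinset_insert, Set.toFinset_singleton]
  exact Finset.card_le_two

lemma map_E2_eq_span {g : Matrix (Fin 8) (Fin 8) F} {u v : Fin 8 → F}
    (hu : u ∈ (E2 F).map g.mulVecLin) (hv : v ∈ (E2 F).map g.mulVecLin)
    (h : LinearIndependent F ![u, v]) : Submodule.span F {u, v} = (E2 F).map g.mulVecLin := by
  refine Submodule.eq_of_le_of_finrank_le (Submodule.span_le.2 (Set.pair_subset hu hv)) ?_
  refine (finrank_map_E2_le g).trans ?_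
  rw [← Matrix.range_cons_cons_empty u v ![], finrank_span_eq_card h, Fintype.card_fin]

lemma isotropic_map_E2 {g : Matrix (Fin 8) (Fin 8) F} (hg : g ∈ Sp8 F) {u v : Fin 8 → F}
    (hu : u ∈ (E2 F).map g.mulVecLin) (hv : v ∈ (E2 F).map g.mulVecLin) :
    u ⬝ᵥ (OmegaMat F 4 *ᵥ v) = 0 := by
  have key {w : Fin 8 → F} (hw : w ∈ E2 F) : w ∈ lagrangian F := by
    refine (Submodule.span_le.2 ?_ : E2 F ≤ lagrangian F) hw
    rintro _ (rfl | rfl) i hi <;> refine Pi.single_eq_of_ne ?_ _ <;> rintro rfl <;> simp at hi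
  obtain ⟨x, hx, rfl⟩ := hu
  obtain ⟨y, hy, rfl⟩ := hv
  rw [mulVecLin_apply, mulVecLin_apply, Sp8.dot_Omega hg]
  obtain ⟨x, x', rfl⟩ := exists_eq_vec8 x
  obtain ⟨y, y', rfl⟩ := exists_eq_vec8 y
  rw [vec8_dot_Omega, vec8_mem_lagrangian.1 (key hx), vec8_mem_lagrangian.1 (key hy)]
  simp

lemma exists_linearIndependent_map_E2 {g : Matrix (Fin 8) (Fin 8) F} (hg : g ∈ Sp8 F) :
    ∃ u ∈ (E2 F).map g.mulVecLin, ∃ v ∈ (E2 F).map g.mulVecLin,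
      LinearIndependent F ![u, v] := by
  refine ⟨_, Submodule.mem_map_of_mem (Submodule.subset_span (Set.mem_insert _ _)), _,
    Submodule.mem_map_of_mem (Submodule.subset_span (Set.mem_insert_of_mem _ rfl)), ?_⟩
  rw [LinearIndependent.pair_iff]
  intro s t hst
  rw [← map_smul, ← map_smul, ← map_add] at hst
  have h := Sp8.injective hg (hst.trans (map_zero _).symm)
  have h0 := congrFun h 0
  have h1 := congrFun h 1
  simp at h0 h1
  exact ⟨h0, h1⟩

lemma exists_dual {a : Matrix (Fin 4) (Fin 4) F} (ha : IsUnit a) :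
    ∃ d, aᵀ * Jmat F 4 * d = Jmat F 4 := by
  obtain ⟨b, hb⟩ := ha.exists_right_inv
  refine ⟨Jmat F 4 * bᵀ * Jmat F 4, ?_⟩
  have hb' : bᵀ * aᵀ = 1 := by rw [← transpose_mul, hb, transpose_one]
  calc _ = aᵀ * (Jmat F 4 * Jmat F 4) * bᵀ * Jmat F 4 := by simp only [mul_assoc]
    _ = _ := by rw [Jmat_mul_self, mul_one, mul_eq_one_comm.1 hb', one_mul]

lemma isUnit_of_dual {a d : Matrix (Fin 4) (Fin 4) F} (h : aᵀ * Jmat F 4 * d = Jmat F 4) :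
    IsUnit a := by
  rw [← isUnit_transpose]
  refine IsUnit.of_mul_eq_one (Jmat F 4 * d * Jmat F 4) ?_
  rw [← mul_assoc, ← mul_assoc, h, Jmat_mul_self]

lemma mem_dcoset_one {g : Matrix (Fin 8) (Fin 8) F} (hg : g ∈ Sp8 F)
    (h : (E2 F).map g.mulVecLin ≤ lagrangian F) : g ∈ dcoset F 1 := by
  obtain ⟨u, hu, v, hv, huv⟩ := exists_linearIndependent_map_E2 hg
  have hspan := map_E2_eq_span hu hv huv
  obtain ⟨x, x', rfl⟩ := exists_eq_vec8 u
  obtain ⟨y, y', rfl⟩ := exists_eq_vec8 v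
  obtain rfl := vec8_mem_lagrangian.1 (h hu)
  obtain rfl := vec8_mem_lagrangian.1 (h hv)
  have hxy : LinearIndependent F ![x, y] := by
    rw [LinearIndependent.pair_iff] at huv ⊢
    intro s t hst
    exact huv s t (by rw [vec8_smul_add, hst, smul_zero, smul_zero, add_zero, vec8_zero])
  obtain ⟨a, ha, rfl, rfl⟩ := exists_isUnit_mulVec_single (i := (0 : Fin 4)) (j := 1)
    (by decide) hxy
  obtain ⟨d, hd⟩ := exists_dual ha
  obtain ⟨p, hp, hpv⟩ := exists_mem_P8 hd (transpose_zero : (0 : Matrix (Fin 4) (Fin 4) F)ᵀ = 0)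
  refine mem_dcoset hg Sp8.one hp ?_
  rw [← hspan, map_one_E2, Submodule.map_span, Set.image_pair, mulVecLin_apply, mulVecLin_apply,
    hpv, hpv]
  simp

lemma mem_dcoset_gamma1 {g : Matrix (Fin 8) (Fin 8) F} (hg : g ∈ Sp8 F)
    (h : ¬ (E2 F).map g.mulVecLin ≤ lagrangian F)
    (h' : ¬ Disjoint ((E2 F).map g.mulVecLin) (lagrangian F)) : g ∈ dcoset F (gamma1 F) := by
  obtain ⟨u, hu, huL⟩ := SetLike.not_le_iff_exists.1 h
  rw [Submodule.disjoint_def] at h'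
  push Not at h'
  obtain ⟨z, hz, hzL, hz0⟩ := h'
  obtain ⟨x, x', rfl⟩ := exists_eq_vec8 z
  obtain ⟨y, c, rfl⟩ := exists_eq_vec8 u
  obtain rfl := vec8_mem_lagrangian.1 hzL
  rw [vec8_mem_lagrangian] at huL
  have hx : x ≠ 0 := by rintro rfl; exact hz0 vec8_zero
  have hli : LinearIndependent F ![vec8 x 0, vec8 y c] := by
    rw [LinearIndependent.pair_iff' hz0]
    intro t ht
    have := (lagrangian F).smul_mem t hzL
    rw [ht, vec8_mem_lagrangian] at this
    exact huL this
  have hspan := map_E2_eq_span hz hu hli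
  have hiso := isotropic_map_E2 hg hz hu
  rw [vec8_dot_Omega, zero_dotProduct, sub_zero, dotProduct_comm] at hiso
  have hJc : Jmat F 4 *ᵥ c ≠ 0 := fun h0 => huL (by
    rw [← Jmat_mulVec_Jmat_mulVec c, h0, mulVec_zero])
  obtain ⟨a, ha, rfl, hac⟩ := exists_isUnit_mulVec_transpose_mulVec hx hJc hiso
  obtain ⟨d, hd⟩ := exists_dual ha
  obtain ⟨w, rfl⟩ := (mulVec_surjective_iff_isUnit.2 ha) y
  obtain ⟨T, hT, -, hT3⟩ := exists_symm_of_columns (Pi.single 3 ((Jmat F 4 *ᵥ w) 2))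
    (Jmat F 4 *ᵥ w) (by simp)
  have hdc : d *ᵥ Pi.single 3 1 = c := by
    have h3 : Jmat F 4 *ᵥ Pi.single 3 1 = (Pi.single 0 1 : Fin 4 → F) := by
      ext i; rw [Jmat_mulVec_apply]; fin_cases i <;> simp [Fin.rev]
    have hat : Function.Injective (aᵀ *ᵥ ·) :=
      mulVec_injective_iff_isUnit.2 ((isUnit_transpose _).2 ha)
    have : Jmat F 4 *ᵥ (d *ᵥ Pi.single 3 1) = Jmat F 4 *ᵥ c := hat (by
      simp only [hac]
      rw [mulVec_mulVec, mulVec_mulVec, hd, h3])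
    rw [← Jmat_mulVec_Jmat_mulVec (d *ᵥ Pi.single 3 1), this, Jmat_mulVec_Jmat_mulVec]
  obtain ⟨p, hp, hpv⟩ := exists_mem_P8 hd hT
  refine mem_dcoset hg gamma1_mem_Sp8 hp ?_
  rw [← hspan, map_gamma1_E2, Submodule.map_span, Set.image_pair, mulVecLin_apply, mulVecLin_apply,
    hpv, hpv, hT3, hdc, Jmat_mulVec_Jmat_mulVec]
  simp only [mulVec_zero, add_zero, zero_add]

lemma mem_dcoset_gamma2 {g : Matrix (Fin 8) (Fin 8) F} (hg : g ∈ Sp8 F)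
    (h : Disjoint ((E2 F).map g.mulVecLin) (lagrangian F)) : g ∈ dcoset F (gamma2 F) := by
  obtain ⟨u, hu, v, hv, huv⟩ := exists_linearIndependent_map_E2 hg
  have hspan := map_E2_eq_span hu hv huv
  have hiso := isotropic_map_E2 hg hu hv
  obtain ⟨x, b, rfl⟩ := exists_eq_vec8 u
  obtain ⟨y, c, rfl⟩ := exists_eq_vec8 v
  have hbc : LinearIndependent F ![b, c] := by
    rw [LinearIndependent.pair_iff] at huv ⊢
    intro s t hst
    refine huv s t (Submodule.disjoint_def.1 h _
      (add_mem (Submodule.smul_mem _ _ hu) (Submodule.smul_mem _ _ hv)) ?_)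
    rw [vec8_smul_add, vec8_mem_lagrangian, hst]
  obtain ⟨d, hd, rfl, rfl⟩ := exists_isUnit_mulVec_single (i := (2 : Fin 4)) (j := 3)
    (by decide) hbc
  obtain ⟨a, hda⟩ := exists_dual hd
  have had : aᵀ * Jmat F 4 * d = Jmat F 4 := by
    simpa [Jmat_transpose, mul_assoc] using congrArg transpose hda
  have ha := isUnit_of_dual had
  obtain ⟨w, rfl⟩ := (mulVec_surjective_iff_isUnit.2 ha) x
  obtain ⟨z, rfl⟩ := (mulVec_surjective_iff_isUnit.2 ha) y
  rw [vec8_dot_Omega, dot_Jmat_of_dual had, dot_Jmat_of_dual hda, sub_eq_zero] at hiso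
  obtain ⟨T, hT, hT2, hT3⟩ := exists_symm_of_columns (Jmat F 4 *ᵥ w) (Jmat F 4 *ᵥ z) (by
    rw [← single_one_dotProduct 2 (Jmat F 4 *ᵥ z), ← hiso, dotProduct_mulVec, ← mulVec_transpose,
      Jmat_transpose, dotProduct_single_one])
  obtain ⟨p, hp, hpv⟩ := exists_mem_P8 had hT
  refine mem_dcoset hg gamma2_mem_Sp8 hp ?_
  rw [← hspan, map_gamma2_E2, Submodule.map_span, Set.image_pair, mulVecLin_apply, mulVecLin_apply,
    hpv, hpv, hT2, hT3, Jmat_mulVec_Jmat_mulVec, Jmat_mulVec_Jmat_mulVec, zero_add, zero_add]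

lemma map_one_E2_le_lagrangian :
    (E2 F).map (1 : Matrix (Fin 8) (Fin 8) F).mulVecLin ≤ lagrangian F := by
  rw [map_one_E2, Submodule.span_le, Set.pair_subset_iff]
  exact ⟨vec8_mem_lagrangian.2 rfl, vec8_mem_lagrangian.2 rfl⟩

lemma not_map_gamma1_E2_le_lagrangian :
    ¬ (E2 F).map (gamma1 F).mulVecLin ≤ lagrangian F := by
  rw [map_gamma1_E2, Submodule.span_le, Set.pair_subset_iff, SetLike.mem_coe, SetLike.mem_coe,
    vec8_mem_lagrangian, vec8_mem_lagrangian]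
  simp

lemma not_disjoint_map_gamma1_E2_lagrangian :
    ¬ Disjoint ((E2 F).map (gamma1 F).mulVecLin) (lagrangian F) := by
  rw [map_gamma1_E2, Submodule.disjoint_def]
  intro h
  have := h (vec8 (Pi.single 1 1) 0) (Submodule.subset_span (Set.mem_insert _ _))
    (vec8_mem_lagrangian.2 rfl)
  simpa [vec8] using congrFun this (halves (Sum.inl 1))

lemma disjoint_map_gamma2_E2_lagrangian :
    Disjoint ((E2 F).map (gamma2 F).mulVecLin) (lagrangian F) := by
  rw [map_gamma2_E2, Submodule.disjoint_def]
  intro v hv hL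
  obtain ⟨s, t, rfl⟩ := Submodule.mem_span_pair.1 hv
  rw [vec8_smul_add] at hL ⊢
  rw [vec8_mem_lagrangian.1 hL, smul_zero, smul_zero, add_zero, vec8_zero]

lemma not_map_gamma2_E2_le_lagrangian :
    ¬ (E2 F).map (gamma2 F).mulVecLin ≤ lagrangian F := by
  rw [map_gamma2_E2, Submodule.span_le, Set.pair_subset_iff, SetLike.mem_coe, SetLike.mem_coe,
    vec8_mem_lagrangian, vec8_mem_lagrangian]
  simp

lemma dcoset_subset_Sp8 {γ : Matrix (Fin 8) (Fin 8) F} (hγ : γ ∈ Sp8 F) :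
    dcoset F γ ⊆ Sp8 F := by
  rintro _ ⟨p, hp, q, hq, rfl⟩
  exact Sp8.mul (Sp8.mul hp.1 hγ) hq.1

end

/-- `γ₁, γ₂ ∈ Sp_8(F)`, and `Sp_8(F)` is the disjoint union of the three
double cosets `P_8(F)·P_{2,8}(F)`, `P_8(F)·γ₁·P_{2,8}(F)`, `P_8(F)·γ₂·P_{2,8}(F)`. -/
theorem statement13 (F : Type*) [Field F] :
    gamma1 F ∈ Sp8 F ∧
    gamma2 F ∈ Sp8 F ∧
    (Sp8 F = dcoset F 1 ∪ dcoset F (gamma1 F) ∪ dcoset F (gamma2 F)) ∧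
    Disjoint (dcoset F 1) (dcoset F (gamma1 F)) ∧
    Disjoint (dcoset F 1) (dcoset F (gamma2 F)) ∧
    Disjoint (dcoset F (gamma1 F)) (dcoset F (gamma2 F)) := by
  refine ⟨gamma1_mem_Sp8, gamma2_mem_Sp8, ?_, ?_, ?_, ?_⟩
  · apply Set.Subset.antisymm
    · intro g hg
      by_cases h : (E2 F).map g.mulVecLin ≤ lagrangian F
      · exact Or.inl (Or.inl (mem_dcoset_one hg h))
      · by_cases h' : Disjoint ((E2 F).map g.mulVecLin) (lagrangian F)
        · exact Or.inr (mem_dcoset_gamma2 hg h')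
        · exact Or.inl (Or.inr (mem_dcoset_gamma1 hg h h'))
    · exact Set.union_subset (Set.union_subset (dcoset_subset_Sp8 Sp8.one)
        (dcoset_subset_Sp8 gamma1_mem_Sp8)) (dcoset_subset_Sp8 gamma2_mem_Sp8)
  · rw [Set.disjoint_left]
    intro g h h'
    exact not_map_gamma1_E2_le_lagrangian ((le_lagrangian_iff_of_mem_dcoset h').1
      ((le_lagrangian_iff_of_mem_dcoset h).2 map_one_E2_le_lagrangian))
  · rw [Set.disjoint_left]
    intro g h h'
    exact not_map_gamma2_E2_le_lagrangian ((le_lagrangian_iff_of_mem_dcoset h').1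
      ((le_lagrangian_iff_of_mem_dcoset h).2 map_one_E2_le_lagrangian))
  · rw [Set.disjoint_left]
    intro g h h'
    exact not_disjoint_map_gamma1_E2_lagrangian ((disjoint_lagrangian_iff_of_mem_dcoset h).1
      ((disjoint_lagrangian_iff_of_mem_dcoset h').2 disjoint_map_gamma2_E2_lagrangian))

end

end GS
end
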